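/- arXiv:1905.09242 — 6 statements merged into one kernel-verified Lean document; each statement's English description precedes it below -/
import Mathlib

section
/- The restricted inactivity operator F⊥ preserves downwards-closedness with respect to the subsumption preorder ⊑: if X ⊆ Q_P × Set Σ × Q_Π is downwards-closed, then F⊥(X) is downwards-closed. -/
/-- The restricted inactivity operator `F⊥`. -/
def Fbot {QP QPi A : Type*}
    (δP : QP → A → QP) (δPi : QPi → A → QPi)
    (FP : Set QP) (FPi : Set QPi)
    (D : A → Set A) (ℛ : Set (A → Set A))
    (X : Set (QP × Set A × QPi)) : Set (QP × Set A × QPi) :=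
  { p | ∀ R ∈ ℛ, (p.1 ∈ FP → p.2.2 ∈ FPi) →
      ∃ a ∉ p.2.1, (δP p.1 a, (p.2.1 ∪ R a) \ D a, δPi p.2.2 a) ∈ X }

/-- The subsumption preorder on states: same automaton components, smaller sleep set. -/
def Subsumes {QP QPi A : Type*} (p q : QP × Set A × QPi) : Prop :=
  p.1 = q.1 ∧ p.2.2 = q.2.2 ∧ p.2.1 ⊆ q.2.1

/-- A set of states is downwards-closed w.r.t. subsumption. -/
def DownClosed {QP QPi A : Type*} (X : Set (QP × Set A × QPi)) : Prop :=
  ∀ s t, Subsumes s t → t ∈ X → s ∈ X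

/-- `F⊥` preserves downwards-closedness w.r.t. the subsumption preorder. -/
theorem Fbot_preserves_downClosed {QP QPi A : Type*}
    (δP : QP → A → QP) (δPi : QPi → A → QPi)
    (FP : Set QP) (FPi : Set QPi)
    (D : A → Set A) (ℛ : Set (A → Set A))
    (X : Set (QP × Set A × QPi)) (hX : DownClosed X) :
    DownClosed (Fbot δP δPi FP FPi D ℛ X) := by
  rintro ⟨p, S, q⟩ ⟨_, T, _⟩ ⟨rfl, rfl, hST⟩ hT R hR hacc
  obtain ⟨a, haT, ha⟩ := hT R hR hacc
  refine ⟨a, fun haS => haT (hST haS), hX _ _ ?_ ha⟩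
  exact ⟨rfl, rfl, Set.sdiff_subset_sdiff_left (Set.union_subset_union_left _ hST)⟩
end

section
/- The least fixed point lfp F⊥ of the restricted inactivity operator is downwards-closed with respect to the subsumption preorder ⊑. -/
/-- The least fixed point of `F⊥` (the set of inactive states) is downwards-closed
w.r.t. the subsumption preorder. -/
theorem lfp_Fbot_downClosed {QP QPi A : Type*}
    (δP : QP → A → QP) (δPi : QPi → A → QPi)
    (FP : Set QP) (FPi : Set QPi)
    (D : A → Set A) (ℛ : Set (A → Set A))
    (F : Set (QP × Set A × QPi) →o Set (QP × Set A × QPi))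
    (hF : ∀ X, F X = Fbot δP δPi FP FPi D ℛ X) :
    DownClosed (OrderHom.lfp F) := by
  let Y : Set (QP × Set A × QPi) := {t | ∀ s, Subsumes s t → s ∈ OrderHom.lfp F}
  have hY : OrderHom.lfp F ≤ Y := by
    refine F.lfp_le fun t ht s hst => ?_
    rw [hF] at ht
    rw [← F.map_lfp, hF]
    obtain ⟨qP, S, qPi⟩ := s
    obtain ⟨qP', T, qPi'⟩ := t
    obtain ⟨rfl, rfl, hST : S ⊆ T⟩ := hst
    intro R hR hacc
    obtain ⟨a, ha, hsucc⟩ := ht R hR hacc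
    exact ⟨a, fun h => ha (hST h), hsucc _
      ⟨rfl, rfl, Set.sdiff_subset_sdiff_left (Set.union_subset_union_left _ hST)⟩⟩
  exact fun s t hst ht => hY ht s hst
end

section
/- Fix qP : Q_P, qΠ : Q_Π and a family X : Q_P × Q_Π → Set (Set Σ), and write qP' = δ_P qP a and qΠ' = δ_Π qΠ a. Then { S : Set Σ | ∀ R ∈ ℛ, ∃ a ∉ S, ∃ T ∈ X (qP', qΠ'), (S ∪ R a) \ D a ⊆ T } = { S : Set Σ | ∀ R ∈ ℛ, ∃ a, ∃ T ∈ X (qP', qΠ'), R a \ D a ⊆ T ∧ S ⊆ (T ∪ D a) \ {a} }. -/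
/-- A set `S` avoiding `a` has successor sleep set `(S ∪ R) \ D` below `T` exactly when
`R \ D` is below `T` and `S` is below `(T ∪ D) \ {a}`. -/
theorem Set.notMem_and_union_diff_subset_iff {A : Type*} {a : A} {S R D T : Set A} :
    a ∉ S ∧ (S ∪ R) \ D ⊆ T ↔ R \ D ⊆ T ∧ S ⊆ (T ∪ D) \ {a} := by
  rw [Set.union_sdiff_distrib, Set.union_subset_iff, Set.subset_sdiff,
    Set.disjoint_singleton_right, Set.union_comm T D, ← Set.sdiff_subset_iff]
  tauto

/-- Core set identity underlying the functional characterization of the antichain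
operator `F^max`: membership via the successor sleep set `(S ∪ R a) \ D a ⊆ T`
is rewritten into the bound `S ⊆ (T ∪ D a) \ {a}`. -/
theorem fmax_core_identity {QP QPi A : Type*}
    (δP : QP → A → QP) (δPi : QPi → A → QPi)
    (D : A → Set A) (ℛ : Set (A → Set A))
    (qP : QP) (qPi : QPi) (X : QP × QPi → Set (Set A)) :
    { S : Set A | ∀ R ∈ ℛ, ∃ a ∉ S,
        ∃ T ∈ X (δP qP a, δPi qPi a), (S ∪ R a) \ D a ⊆ T } =
    { S : Set A | ∀ R ∈ ℛ, ∃ a,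
        ∃ T ∈ X (δP qP a, δPi qPi a), R a \ D a ⊆ T ∧ S ⊆ (T ∪ D a) \ {a} } := by
  ext S
  refine forall₂_congr fun R _ => exists_congr fun a => ?_
  simp only [← Set.notMem_and_union_diff_subset_iff]
  tauto
end

section
/- Let S, S' : Set Σ with S ⊆ S', let qP : Q_P, qΠ : Q_Π, and let f : (Σ → Set Σ) → Σ be a witness function satisfying: for all R ∈ ℛ, if (qP ∈ F_P → qΠ ∈ F_Π) then f R ∉ S' and (δ_P qP (f R), (S' ∪ R (f R)) \ D (f R), δ_Π qΠ (f R)) ∈ lfp F⊥. Then f is also a witness for S: for all R ∈ ℛ, if (qP ∈ F_P → qΠ ∈ F_Π) then f R ∉ S and (δ_P qP (f R), (S ∪ R (f R)) \ D (f R), δ_Π qΠ (f R)) ∈ lfp F⊥. -/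
/-- The least fixed point of the restricted inactivity operator is closed under shrinking
the sleep set. -/
theorem mem_lfp_Fbot_of_subset {QP QPi A : Type*}
    {δP : QP → A → QP} {δPi : QPi → A → QPi}
    {FP : Set QP} {FPi : Set QPi}
    {D : A → Set A} {ℛ : Set (A → Set A)}
    {F : Set (QP × Set A × QPi) →o Set (QP × Set A × QPi)}
    (hF : ∀ X, F X = Fbot δP δPi FP FPi D ℛ X)
    {S S' : Set A} (hSS' : S ⊆ S') {qP : QP} {qPi : QPi}
    (h : (qP, S', qPi) ∈ OrderHom.lfp F) : (qP, S, qPi) ∈ OrderHom.lfp F := by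
  have key : OrderHom.lfp F ≤ {p | ∀ T ⊆ p.2.1, (p.1, T, p.2.2) ∈ OrderHom.lfp F} := by
    refine OrderHom.lfp_le F ?_
    intro p hp T hT
    rw [hF] at hp
    rw [← OrderHom.map_lfp, hF]
    intro R hR hacc
    obtain ⟨a, ha, hnext⟩ := hp R hR hacc
    exact ⟨a, fun haT => ha (hT haT),
      hnext _ (Set.sdiff_subset_sdiff_left (Set.union_subset_union_left _ hT))⟩
  exact key h S hSS'

/-- An inactivity witness `f` recorded for a subsuming state (sleep set `S'`) can be
reused for every state it subsumes (sleep set `S ⊆ S'`). -/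
theorem witness_reuse {QP QPi A : Type*}
    (δP : QP → A → QP) (δPi : QPi → A → QPi)
    (FP : Set QP) (FPi : Set QPi)
    (D : A → Set A) (ℛ : Set (A → Set A))
    (F : Set (QP × Set A × QPi) →o Set (QP × Set A × QPi))
    (hF : ∀ X, F X = Fbot δP δPi FP FPi D ℛ X)
    (S S' : Set A) (hSS' : S ⊆ S') (qP : QP) (qPi : QPi)
    (f : (A → Set A) → A)
    (hwit : ∀ R ∈ ℛ, (qP ∈ FP → qPi ∈ FPi) →
      f R ∉ S' ∧
        (δP qP (f R), (S' ∪ R (f R)) \ D (f R), δPi qPi (f R)) ∈ OrderHom.lfp F) :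
    ∀ R ∈ ℛ, (qP ∈ FP → qPi ∈ FPi) →
      f R ∉ S ∧
        (δP qP (f R), (S ∪ R (f R)) \ D (f R), δPi qPi (f R)) ∈ OrderHom.lfp F := by
  intro R hR hacc
  obtain ⟨hf, hnext⟩ := hwit R hR hacc
  exact ⟨fun hS => hf (hSS' hS), mem_lfp_Fbot_of_subset hF
    (Set.sdiff_subset_sdiff_left (Set.union_subset_union_left _ hSS')) hnext⟩
end

section
/- Let Q be a finite type equipped with a partial order and let F : Set Q → Set Q be a monotone function that maps lower sets to lower sets. Define F^max : Set Q → Set Q by F^max(X) = max(F(⌊X⌋)). Then for every natural number n, the n-th iterate satisfies (F^max)^[n](∅) = max(F^[n](∅)); that is, iterating F^max from the empty set computes exactly the maximal elements of the iterates of F, and hence the antichain fixpoint computation lfp(max ∘ F ∘ ⌊-⌋) computes max(lfp F). -/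
/-- In a finite partial order, a lower set is the lower closure of its maximal elements. -/
theorem IsLowerSet.coe_lowerClosure_setOf_maximal {Q : Type*} [Finite Q] [PartialOrder Q]
    {S : Set Q} (hS : IsLowerSet S) :
    (↑(lowerClosure {m ∈ S | ∀ y ∈ S, m ≤ y → m = y}) : Set Q) = S := by
  ext x
  simp only [SetLike.mem_coe, mem_lowerClosure]
  constructor
  · rintro ⟨m, hm, hxm⟩
    exact hS hxm hm.1
  · intro hx
    obtain ⟨m, hxm, hm⟩ := S.toFinite.exists_le_maximal hx
    exact ⟨m, ⟨hm.prop, fun y hy hmy => hm.eq_of_le hy hmy⟩, hxm⟩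

/-- On a finite complete lattice, the least fixed point of a monotone map is reached by
iterating the map from `⊥`. -/
theorem OrderHom.exists_iterate_bot_eq_lfp {α : Type*} [CompleteLattice α] [Finite α]
    (f : α →o α) : ∃ n : ℕ, (⇑f)^[n] ⊥ = f.lfp := by
  obtain ⟨n, hn⟩ := WellFoundedGT.monotone_chain_condition
    ⟨fun n => (⇑f)^[n] ⊥, f.monotone.monotone_iterate_of_le_map bot_le⟩
  refine ⟨n, le_antisymm ?_ (f.lfp_le ?_)⟩
  · clear hn
    induction n with
    | zero => exact bot_le
    | succ k ih =>
      rw [Function.iterate_succ_apply']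
      exact (f.monotone ih).trans_eq f.map_lfp
  · rw [← Function.iterate_succ_apply' (⇑f)]
    exact (hn (n + 1) n.le_succ).ge

/-- Correctness of the antichain fixpoint computation: for a monotone `F` on subsets
of a finite partial order that maps lower sets to lower sets, iterating
`F^max = max ∘ F ∘ ⌊-⌋` from `∅` computes exactly the maximal elements of the
iterates of `F`, and hence the antichain fixpoint computation reaches
`max (lfp F)`. -/
theorem antichain_fixpoint_correct {Q : Type*} [Fintype Q] [PartialOrder Q]
    (F : Set Q →o Set Q)
    (hF : ∀ X : Set Q, IsLowerSet X → IsLowerSet (F X)) :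
    (∀ n : ℕ,
      (fun X : Set Q =>
          { m ∈ F (↑(lowerClosure X)) | ∀ y ∈ F (↑(lowerClosure X)), m ≤ y → m = y })^[n]
        ∅ =
      { m ∈ (⇑F)^[n] ∅ | ∀ y ∈ (⇑F)^[n] ∅, m ≤ y → m = y }) ∧
    (∃ n : ℕ,
      (fun X : Set Q =>
          { m ∈ F (↑(lowerClosure X)) | ∀ y ∈ F (↑(lowerClosure X)), m ≤ y → m = y })^[n]
        ∅ =
      { m ∈ OrderHom.lfp F | ∀ y ∈ OrderHom.lfp F, m ≤ y → m = y }) := by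
  have isLowerSet_iterate (n : ℕ) : IsLowerSet ((⇑F)^[n] ∅) := by
    induction n with
    | zero => exact isLowerSet_empty
    | succ n ih =>
      rw [Function.iterate_succ_apply']
      exact hF _ ih
  have iterate_eq (n : ℕ) :
      (fun X : Set Q =>
          { m ∈ F (↑(lowerClosure X)) | ∀ y ∈ F (↑(lowerClosure X)), m ≤ y → m = y })^[n]
        ∅ =
      { m ∈ (⇑F)^[n] ∅ | ∀ y ∈ (⇑F)^[n] ∅, m ≤ y → m = y } := by
    induction n with
    | zero => simp
    | succ n ih =>
      rw [Function.iterate_succ_apply', Function.iterate_succ_apply', ih]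
      simp only [(isLowerSet_iterate n).coe_lowerClosure_setOf_maximal]
  obtain ⟨n, hn⟩ := F.exists_iterate_bot_eq_lfp
  rw [Set.bot_eq_empty] at hn
  exact ⟨iterate_eq, n, by rw [iterate_eq, hn]⟩
end

section
/- Let X, Y : Set (Set α) be finite families of sets, and define the antichain meet X ⊓ Y = max { x ∩ y | x ∈ X, y ∈ Y } (maximal elements with respect to ⊆). Then the lower closure of X ⊓ Y equals the intersection of the lower closures: ⌊X ⊓ Y⌋ = ⌊X⌋ ∩ ⌊Y⌋, where ⌊X⌋ = { S | ∃ x ∈ X, S ⊆ x }. -/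
/-- `⊆`-maximal members of a family of sets. -/
def maxSets {α : Type*} (X : Set (Set α)) : Set (Set α) :=
  { S ∈ X | ∀ T ∈ X, S ⊆ T → S = T }

/-- Downward closure of a family of sets under `⊆`. -/
def downSets {α : Type*} (X : Set (Set α)) : Set (Set α) :=
  { S | ∃ x ∈ X, S ⊆ x }

/-- Every member of a finite family of sets lies below a maximal one, so passing to the maximal
members does not change the downward closure. -/
theorem downSets_maxSets_of_finite {α : Type*} {X : Set (Set α)} (hX : X.Finite) :
    downSets (maxSets X) = downSets X := by
  ext S
  constructor
  · rintro ⟨x, hx, hS⟩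
    exact ⟨x, hx.1, hS⟩
  · rintro ⟨x, hx, hS⟩
    obtain ⟨m, hxm, hm⟩ := hX.exists_le_maximal hx
    exact ⟨m, ⟨hm.prop, fun T hT hmT => hm.eq_of_le hT hmT⟩, hS.trans hxm⟩

/-- Correctness of the antichain meet: for finite families `X, Y`, the lower closure
of `X ⊓ Y = max { x ∩ y | x ∈ X, y ∈ Y }` is `⌊X⌋ ∩ ⌊Y⌋`. -/
theorem antichain_meet_correct {α : Type*} (X Y : Set (Set α))
    (hX : X.Finite) (hY : Y.Finite) :
    downSets (maxSets { z | ∃ x ∈ X, ∃ y ∈ Y, z = x ∩ y }) =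
      downSets X ∩ downSets Y := by
  have hfin : { z | ∃ x ∈ X, ∃ y ∈ Y, z = x ∩ y }.Finite := by
    refine (hX.image2 (· ∩ ·) hY).subset ?_
    rintro z ⟨x, hx, y, hy, rfl⟩
    exact Set.mem_image2_of_mem hx hy
  rw [downSets_maxSets_of_finite hfin]
  ext S
  constructor
  · rintro ⟨_, ⟨x, hx, y, hy, rfl⟩, hS⟩
    exact ⟨⟨x, hx, hS.trans Set.inter_subset_left⟩, ⟨y, hy, hS.trans Set.inter_subset_right⟩⟩
  · rintro ⟨⟨x, hx, hSx⟩, ⟨y, hy, hSy⟩⟩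
    exact ⟨x ∩ y, ⟨x, hx, y, hy, rfl⟩, Set.subset_inter hSx hSy⟩
end
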